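/- arXiv:0802.0006 — 2 statements merged into one kernel-verified Lean document; each statement's English description precedes it below -/
import Mathlib

section
/- Let f : [a,b] → ℝ be continuous and matrix convex, i.e., for every n the map T ↦ f(T) (defined by the spectral functional calculus) is convex on the self-adjoint n×n complex matrices with spectrum contained in [a,b]. Then for any m×n complex matrices A and B with A*A + B*B = Iₙ and any self-adjoint m×m matrix T with spectrum in [a,b], one has f(A*TA + B*TB) ≤ A* f(T) A + B* f(T) B in the Loewner order (here A*TA + B*TB is self-adjoint with spectrum in [a,b]). -/
open Matrix
open scoped ComplexOrder

/-- `f` is matrix convex on `[a,b]`: for every size `k`, the map `T ↦ f(T)` (continuous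
functional calculus) is convex, in the Loewner order, on the self-adjoint `k × k` complex
matrices with spectrum contained in `[a,b]`. -/
def IsMatrixConvexOn (a b : ℝ) (f : ℝ → ℝ) : Prop :=
  ∀ (k : ℕ) (S T : Matrix (Fin k) (Fin k) ℂ), S.IsHermitian → T.IsHermitian →
    spectrum ℝ S ⊆ Set.Icc a b → spectrum ℝ T ⊆ Set.Icc a b →
    ∀ c : ℝ, 0 ≤ c → c ≤ 1 →
      (c • cfc f S + (1 - c) • cfc f T - cfc f (c • S + (1 - c) • T)).PosSemidef

/-- The functional calculus respects intertwiners: if `M W = W N` then `f(M) W = W f(N)`. -/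
lemma cfc_mul_eq_mul_cfc {p q : Type*} [Fintype p] [DecidableEq p] [Fintype q] [DecidableEq q]
    (f : ℝ → ℝ) {M : Matrix p p ℂ} {N : Matrix q q ℂ} (hM : M.IsHermitian) (hN : N.IsHermitian)
    {W : Matrix p q ℂ} (h : M * W = W * N) : cfc f M * W = W * cfc f N := by
  have hfin : (spectrum ℝ M ∪ spectrum ℝ N).Finite :=
    Matrix.finite_real_spectrum.union Matrix.finite_real_spectrum
  obtain ⟨P, hP⟩ : ∃ P : Polynomial ℝ, ∀ x ∈ spectrum ℝ M ∪ spectrum ℝ N, f x = P.eval x :=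
    ⟨Lagrange.interpolate hfin.toFinset id f, fun x hx =>
      (Lagrange.eval_interpolate_at_node f (Set.injOn_id _) (hfin.mem_toFinset.2 hx)).symm⟩
  rw [cfc_congr (a := M) fun x hx => hP x (.inl hx), cfc_congr (a := N) fun x hx => hP x (.inr hx),
    cfc_polynomial P M hM.isSelfAdjoint, cfc_polynomial P N hN.isSelfAdjoint]
  clear hP
  have hpow (k : ℕ) : M ^ k * W = W * N ^ k := by
    induction k with
    | zero => simp
    | succ k ih => rw [pow_succ, Matrix.mul_assoc, h, ← Matrix.mul_assoc, ih, Matrix.mul_assoc,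
        ← pow_succ]
  induction P using Polynomial.induction_on' with
  | add P Q hP hQ => rw [map_add, map_add, Matrix.add_mul, Matrix.mul_add, hP, hQ]
  | monomial k c =>
    simp only [Polynomial.aeval_monomial, ← Algebra.smul_def, Matrix.smul_mul, Matrix.mul_smul, hpow]

/-- Jensen's inequality for a single isometry: `f(Vᴴ X V) ≤ Vᴴ f(X) V` if `Vᴴ V = 1`. -/
lemma IsMatrixConvexOn.posSemidef_conjTranspose_mul_cfc_mul_sub {a b : ℝ} {f : ℝ → ℝ}
    (hconv : IsMatrixConvexOn a b f) {n k : ℕ} {V : Matrix (Fin k) (Fin n) ℂ} (hV : Vᴴ * V = 1)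
    {X : Matrix (Fin k) (Fin k) ℂ} (hX : X.IsHermitian) (hXspec : spectrum ℝ X ⊆ Set.Icc a b) :
    (Vᴴ * cfc f X * V - cfc f (Vᴴ * X * V)).PosSemidef := by
  set S : Matrix (Fin k) (Fin k) ℂ := (2 : ℝ) • (V * Vᴴ) - 1 with hS
  have hSV : S * V = V := by
    rw [hS, Matrix.sub_mul, Matrix.smul_mul, Matrix.mul_assoc, hV, Matrix.mul_one, Matrix.one_mul,
      two_smul, add_sub_cancel_right]
  have hSh : Sᴴ = S := by simp [hS]
  have hVS : Vᴴ * S = Vᴴ := by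
    simpa [hSh] using congrArg conjTranspose hSV
  have hSS : S * S = 1 := by
    nth_rw 2 [hS]
    rw [Matrix.mul_sub, Matrix.mul_smul, ← Matrix.mul_assoc, hSV, Matrix.mul_one, hS]
    abel
  have hSX : (S * X * S).IsHermitian := by
    simpa [hSh] using Matrix.isHermitian_conjTranspose_mul_mul S hX
  have hSXspec : spectrum ℝ (S * X * S) ⊆ Set.Icc a b := by
    have := spectrum.units_conjugate (R := ℝ) (a := X) (u := ⟨S, S, hSS, hSS⟩)
    exact this.trans_subset hXspec
  have hfS : cfc f (S * X * S) * S = S * cfc f X :=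
    cfc_mul_eq_mul_cfc f hSX hX (by rw [Matrix.mul_assoc, hSS, Matrix.mul_one])
  have hC : (Vᴴ * X * V).IsHermitian := Matrix.isHermitian_conjTranspose_mul_mul V hX
  set Y : Matrix (Fin k) (Fin k) ℂ := (1 / 2 : ℝ) • X + (1 - 1 / 2 : ℝ) • (S * X * S) with hY
  have hYh : Y.IsHermitian := by
    have h₁ := hX.eq
    have h₂ := hSX.eq
    rw [Matrix.IsHermitian, hY, conjTranspose_add, conjTranspose_smul, conjTranspose_smul, h₁, h₂]
    simp
  have hYV : Y * V = V * (Vᴴ * X * V) := by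
    rw [hY, Matrix.add_mul, Matrix.smul_mul, Matrix.smul_mul, Matrix.mul_assoc _ S V, hSV,
      Matrix.mul_assoc S, hS, Matrix.sub_mul, Matrix.smul_mul, Matrix.one_mul]
    simp only [Matrix.mul_assoc]
    module
  have hfY : Vᴴ * cfc f Y * V = cfc f (Vᴴ * X * V) := by
    rw [Matrix.mul_assoc, cfc_mul_eq_mul_cfc f hYh hC hYV, ← Matrix.mul_assoc, hV, Matrix.one_mul]
  have hfSV : Vᴴ * cfc f (S * X * S) * V = Vᴴ * cfc f X * V := by
    nth_rw 2 [← hSV]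
    rw [Matrix.mul_assoc, ← Matrix.mul_assoc _ S V, hfS, ← Matrix.mul_assoc, ← Matrix.mul_assoc,
      hVS]
  have key := (hconv k X (S * X * S) hX hSX hXspec hSXspec (1 / 2) (by norm_num)
    (by norm_num)).conjTranspose_mul_mul_same V
  rw [← hY, Matrix.mul_sub, Matrix.sub_mul, hfY, Matrix.mul_add, Matrix.add_mul, Matrix.mul_smul,
    Matrix.mul_smul, Matrix.smul_mul, Matrix.smul_mul, hfSV, ← add_smul] at key
  simpa using key

/-- The spectrum of `T ⊕ T` is contained in that of `T`. -/
lemma spectrum_fromBlocks_self_subset {m : Type*} [Fintype m] [DecidableEq m]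
    (T : Matrix m m ℂ) : spectrum ℝ (fromBlocks T 0 0 T) ⊆ spectrum ℝ T := by
  intro r hr hT
  refine hr ?_
  have h : algebraMap ℝ (Matrix (m ⊕ m) (m ⊕ m) ℂ) r - fromBlocks T 0 0 T =
      fromBlocks (algebraMap ℝ _ r - T) 0 0 (algebraMap ℝ _ r - T) := by
    simp only [Algebra.algebraMap_eq_smul_one, ← fromBlocks_one, fromBlocks_smul, smul_zero,
      sub_eq_add_neg, fromBlocks_neg, fromBlocks_add, neg_zero, add_zero]
  rw [spectrum.mem_resolventSet_iff, h]
  exact Matrix.isUnit_fromBlocks_zero₁₂.2 ⟨hT, hT⟩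

/-- Hansen–Pedersen Jensen inequality: if `f` is continuous and matrix convex on `[a,b]`,
`A` and `B` are `m × n` matrices with `AᴴA + BᴴB = 1`, and `T` is self-adjoint with spectrum
in `[a,b]`, then `f(AᴴTA + BᴴTB) ≤ Aᴴ f(T) A + Bᴴ f(T) B` in the Loewner order. -/
theorem hansen_pedersen_jensen {a b : ℝ} (f : ℝ → ℝ)
    (hf : ContinuousOn f (Set.Icc a b))
    (hconv : IsMatrixConvexOn a b f)
    {m n : ℕ} (A B : Matrix (Fin m) (Fin n) ℂ)
    (hAB : Aᴴ * A + Bᴴ * B = 1)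
    (T : Matrix (Fin m) (Fin m) ℂ) (hT : T.IsHermitian)
    (hTspec : spectrum ℝ T ⊆ Set.Icc a b) :
    (Aᴴ * cfc f T * A + Bᴴ * cfc f T * B
      - cfc f (Aᴴ * T * A + Bᴴ * T * B)).PosSemidef := by
  let e : Fin m ⊕ Fin m ≃ Fin (m + m) := finSumFinEquiv
  let J₁ : Matrix (Fin (m + m)) (Fin m) ℂ := (fromRows 1 0).submatrix e.symm id
  let J₂ : Matrix (Fin (m + m)) (Fin m) ℂ := (fromRows 0 1).submatrix e.symm id
  let X : Matrix (Fin (m + m)) (Fin (m + m)) ℂ := (fromBlocks T 0 0 T).submatrix e.symm e.symm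
  have hX : X.IsHermitian := (hT.fromBlocks (by simp) hT).submatrix _
  have hXspec : spectrum ℝ X ⊆ Set.Icc a b := by
    have h : spectrum ℝ X = spectrum ℝ (fromBlocks T 0 0 T) :=
      AlgEquiv.spectrum_eq (Matrix.reindexAlgEquiv ℝ ℂ e) (fromBlocks T 0 0 T)
    exact h.trans_subset ((spectrum_fromBlocks_self_subset T).trans hTspec)
  have hJ₁ : X * J₁ = J₁ * T := by
    ext i j
    obtain ⟨i, rfl⟩ := e.surjective i
    cases i <;> simp [X, J₁, Matrix.mul_apply, ← e.sum_comp, Matrix.one_apply]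
  have hJ₂ : X * J₂ = J₂ * T := by
    ext i j
    obtain ⟨i, rfl⟩ := e.surjective i
    cases i <;> simp [X, J₂, Matrix.mul_apply, ← e.sum_comp, Matrix.one_apply]
  have h₁₁ : J₁ᴴ * J₁ = 1 := by
    ext i j; simp [J₁, Matrix.mul_apply, ← e.sum_comp, Matrix.one_apply, eq_comm]
  have h₂₂ : J₂ᴴ * J₂ = 1 := by
    ext i j; simp [J₂, Matrix.mul_apply, ← e.sum_comp, Matrix.one_apply, eq_comm]
  have h₁₂ : J₁ᴴ * J₂ = 0 := by
    ext i j; simp [J₁, J₂, Matrix.mul_apply, ← e.sum_comp]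
  have h₂₁ : J₂ᴴ * J₁ = 0 := by
    ext i j; simp [J₁, J₂, Matrix.mul_apply, ← e.sum_comp]
  have hcompress {Z : Matrix (Fin (m + m)) (Fin (m + m)) ℂ} {R : Matrix (Fin m) (Fin m) ℂ}
      (h₁ : Z * J₁ = J₁ * R) (h₂ : Z * J₂ = J₂ * R) :
      (J₁ * A + J₂ * B)ᴴ * Z * (J₁ * A + J₂ * B) = Aᴴ * R * A + Bᴴ * R * B := by
    have hZ : Z * (J₁ * A + J₂ * B) = J₁ * (R * A) + J₂ * (R * B) := by
      rw [Matrix.mul_add, ← Matrix.mul_assoc, ← Matrix.mul_assoc, h₁, h₂, Matrix.mul_assoc,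
        Matrix.mul_assoc]
    have hJ {p : Type} {U W : Matrix (Fin (m + m)) (Fin m) ℂ} {L : Matrix (Fin m) p ℂ} :
        Uᴴ * (W * L) = (Uᴴ * W) * L := (Matrix.mul_assoc _ _ _).symm
    rw [Matrix.mul_assoc, hZ]
    simp only [conjTranspose_add, conjTranspose_mul, Matrix.add_mul, Matrix.mul_add,
      Matrix.mul_assoc]
    simp only [hJ, h₁₁, h₁₂, h₂₁, h₂₂, Matrix.one_mul, Matrix.zero_mul, Matrix.mul_zero, add_zero,
      zero_add]
  have hV : (J₁ * A + J₂ * B)ᴴ * (J₁ * A + J₂ * B) = 1 := by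
    simpa [hAB] using hcompress (Z := 1) (R := 1) (by simp) (by simp)
  have key := hconv.posSemidef_conjTranspose_mul_cfc_mul_sub hV hX hXspec
  rwa [hcompress hJ₁ hJ₂, hcompress (cfc_mul_eq_mul_cfc f hX hT hJ₁)
    (cfc_mul_eq_mul_cfc f hX hT hJ₂)] at key
end

section
/- Let f : [0,∞) → ℝ be continuous and matrix convex. For commuting positive definite n×n complex matrices L and R, define the perspective g(L,R) = f(L R⁻¹) R (equivalently R^{1/2} f(R^{-1/2} L R^{-1/2}) R^{1/2}, which coincides since L and R commute). Then g is jointly convex in the following sense: if L₁ commutes with R₁, L₂ commutes with R₂, all four matrices are positive definite, 0 ≤ c ≤ 1, L = cL₁ + (1-c)L₂, and R = cR₁ + (1-c)R₂, then (assuming L commutes with R so that g(L,R) is defined as f(LR⁻¹)R, or stating the conclusion with g(L,R) = R^{1/2} f(R^{-1/2} L R^{-1/2}) R^{1/2}) one has g(L,R) ≤ c·g(L₁,R₁) + (1-c)·g(L₂,R₂) in the Loewner order. -/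
open Matrix
open scoped ComplexOrder

/-- `f` is matrix convex on `[0,∞)`: for every size `k`, the map `T ↦ f(T)` (continuous
functional calculus) is convex, in the Loewner order, on the self-adjoint `k × k` complex
matrices with spectrum contained in `[0,∞)`. -/
def IsMatrixConvexOnIci (f : ℝ → ℝ) : Prop :=
  ∀ (k : ℕ) (S T : Matrix (Fin k) (Fin k) ℂ), S.IsHermitian → T.IsHermitian →
    spectrum ℝ S ⊆ Set.Ici 0 → spectrum ℝ T ⊆ Set.Ici 0 →
    ∀ c : ℝ, 0 ≤ c → c ≤ 1 →
      (c • cfc f S + (1 - c) • cfc f T - cfc f (c • S + (1 - c) • T)).PosSemidef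

/-- The matrix perspective `g(L,R) = f(L R⁻¹) R` of `f`, for commuting positive definite
matrices `L` and `R`. -/
noncomputable def matrixPerspective (f : ℝ → ℝ) {k : ℕ}
    (L R : Matrix (Fin k) (Fin k) ℂ) : Matrix (Fin k) (Fin k) ℂ :=
  cfc f (L * R⁻¹) * R

namespace Matrix

open Polynomial

variable {m n : Type*} [Fintype m] [DecidableEq m] [Fintype n] [DecidableEq n]

/-- On a Hermitian matrix, the functional calculus of `f` is evaluation of any polynomial which
agrees with `f` on the spectrum. -/
theorem IsHermitian.cfc_eq_aeval {A : Matrix n n ℂ} (hA : A.IsHermitian) {f : ℝ → ℝ} {p : ℝ[X]}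
    (h : ∀ x ∈ spectrum ℝ A, p.eval x = f x) : cfc f A = aeval A p := by
  have hA' : IsSelfAdjoint A := hA
  rw [← cfc_congr (f := p.eval) h, cfc_polynomial p A hA']

theorem exists_polynomial_eval_eq {K : Type*} [Field K] (f : K → K) {s : Set K} (hs : s.Finite) :
    ∃ p : K[X], ∀ x ∈ s, p.eval x = f x := by
  classical
  refine ⟨Lagrange.interpolate hs.toFinset id f, fun x hx ↦ ?_⟩
  exact Lagrange.eval_interpolate_at_node f Function.injective_id.injOn (hs.mem_toFinset.2 hx)

theorem IsHermitian.cfc_map {A : Matrix m m ℂ} (hA : A.IsHermitian)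
    (φ : Matrix m m ℂ →ₐ[ℝ] Matrix n n ℂ) (hφ : (φ A).IsHermitian) (f : ℝ → ℝ) :
    cfc f (φ A) = φ (cfc f A) := by
  obtain ⟨p, hp⟩ := exists_polynomial_eval_eq f (finite_real_spectrum (A := A))
  rw [hA.cfc_eq_aeval hp, hφ.cfc_eq_aeval fun x hx ↦ hp x (AlgHom.spectrum_apply_subset φ A hx),
    aeval_algHom_apply]

theorem aeval_fromBlocks_diagonal (p : ℝ[X]) (X : Matrix m m ℂ) (Y : Matrix n n ℂ) :
    aeval (fromBlocks X 0 0 Y) p = fromBlocks (aeval X p) 0 0 (aeval Y p) := by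
  induction p using Polynomial.induction_on' with
  | add p q hp hq => simp [hp, hq, fromBlocks_add]
  | monomial k a =>
    simp [aeval_monomial, fromBlocks_diagonal_pow, ← Algebra.smul_def, fromBlocks_smul]

theorem cfc_fromBlocks_diagonal {X : Matrix m m ℂ} {Y : Matrix n n ℂ} (hX : X.IsHermitian)
    (hY : Y.IsHermitian) (f : ℝ → ℝ) :
    cfc f (fromBlocks X 0 0 Y) = fromBlocks (cfc f X) 0 0 (cfc f Y) := by
  obtain ⟨p, hp⟩ := exists_polynomial_eval_eq f
    (((finite_real_spectrum (A := X)).union (finite_real_spectrum (A := Y))).union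
      (finite_real_spectrum (A := fromBlocks X 0 0 Y)))
  rw [hX.cfc_eq_aeval fun x hx ↦ hp x (.inl (.inl hx)),
    hY.cfc_eq_aeval fun x hx ↦ hp x (.inl (.inr hx)),
    (hX.fromBlocks (by simp) hY).cfc_eq_aeval fun x hx ↦ hp x (.inr hx),
    aeval_fromBlocks_diagonal]

theorem cfc_unitary_conj {U A : Matrix n n ℂ} (hU : Uᴴ * U = 1) (hA : A.IsHermitian) (f : ℝ → ℝ) :
    cfc f (Uᴴ * A * U) = Uᴴ * cfc f A * U := by
  let V : unitary (Matrix n n ℂ) :=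
    ⟨Uᴴ, by simp [Unitary.mem_iff, star_eq_conjTranspose, hU, mul_eq_one_comm.1 hU]⟩
  have hV (M : Matrix n n ℂ) : Unitary.conjStarAlgAut ℝ _ V M = Uᴴ * M * U := by
    simp [V, Unitary.conjStarAlgAut_apply, star_eq_conjTranspose]
  have h := hA.cfc_map (Unitary.conjStarAlgAut ℝ _ V).toAlgEquiv.toAlgHom
    (by simpa [hV] using isHermitian_conjTranspose_mul_mul U hA) f
  simpa [hV] using h

open scoped MatrixOrder in
theorem PosSemidef.fromBlocks_diagonal {X : Matrix m m ℂ} {Y : Matrix n n ℂ}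
    (hX : X.PosSemidef) (hY : Y.PosSemidef) : (fromBlocks X 0 0 Y).PosSemidef := by
  obtain ⟨a, rfl⟩ := CStarAlgebra.nonneg_iff_eq_star_mul_self.mp hX.nonneg
  obtain ⟨b, rfl⟩ := CStarAlgebra.nonneg_iff_eq_star_mul_self.mp hY.nonneg
  simpa [fromBlocks_conjTranspose, fromBlocks_multiply, star_eq_conjTranspose] using
    posSemidef_conjTranspose_mul_self (fromBlocks a 0 0 b)

open scoped MatrixOrder in
theorem PosSemidef.spectrum_real_subset {A : Matrix n n ℂ} (hA : A.PosSemidef) :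
    spectrum ℝ A ⊆ Set.Ici 0 := by
  exact fun _ hx ↦ spectrum_nonneg_of_nonneg hA.nonneg hx

open scoped MatrixOrder in
theorem PosDef.exists_isHermitian_mul_self_eq {P : Matrix n n ℂ} (hP : P.PosDef) :
    ∃ Q : Matrix n n ℂ, Q.IsHermitian ∧ IsUnit Q ∧ Q * Q = P ∧ ∀ T, Commute P T → Commute Q T := by
  have hP0 := hP.posSemidef.nonneg
  refine ⟨CFC.sqrt P, (CFC.sqrt_nonneg P).posSemidef.isHermitian,
    (CFC.isUnit_sqrt_iff P hP0).2 hP.isUnit, CFC.sqrt_mul_sqrt_self P hP0, fun T hT ↦ ?_⟩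
  exact hT.cfcₙ_nnreal _

theorem exists_unitary_fromBlocks {A B : Matrix n n ℂ} (hA : IsUnit A)
    (hAB : Aᴴ * A + Bᴴ * B = 1) :
    ∃ C D : Matrix n n ℂ, (fromBlocks A C B D)ᴴ * fromBlocks A C B D = 1 := by
  have hA' := (isUnit_iff_isUnit_det _).1 hA
  set K := (A⁻¹)ᴴ * Bᴴ with hK
  have hAK : Aᴴ * K = Bᴴ := by
    rw [hK, ← mul_assoc, ← conjTranspose_mul, nonsing_inv_mul _ hA', conjTranspose_one, one_mul]
  have hKA : Kᴴ * A = B := by simpa using congrArg conjTranspose hAK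
  obtain ⟨Q, hQ, hQu, hQQ, -⟩ := (PosDef.one.add_posSemidef
    (posSemidef_conjTranspose_mul_self K)).exists_isHermitian_mul_self_eq
  have hQ' := (isUnit_iff_isUnit_det _).1 hQu
  have hN : (Q⁻¹)ᴴ = Q⁻¹ := hQ.inv
  have hNN : Q⁻¹ * (Kᴴ * K) * Q⁻¹ + Q⁻¹ * Q⁻¹ = 1 := by
    calc _ = Q⁻¹ * (1 + Kᴴ * K) * Q⁻¹ := by noncomm_ring
      _ = 1 := by
        rw [← hQQ, ← mul_assoc, nonsing_inv_mul _ hQ', one_mul, mul_nonsing_inv _ hQ']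
  refine ⟨-(K * Q⁻¹), Q⁻¹, ?_⟩
  rw [fromBlocks_conjTranspose, fromBlocks_multiply, ← fromBlocks_one, fromBlocks_inj]
  refine ⟨hAB, ?_, ?_, ?_⟩
  · simp [← mul_assoc, hAK]
  · simp [mul_assoc, hKA, hN]
  · simpa [mul_assoc, hN] using hNN

end Matrix

namespace IsMatrixConvexOnIci

open Matrix

variable {f : ℝ → ℝ} {n : Type*} [Fintype n] [DecidableEq n]

/-- Matrix convexity for matrices indexed by an arbitrary finite type. -/
theorem posSemidef (hf : IsMatrixConvexOnIci f) {S T : Matrix n n ℂ} (hS : S.PosSemidef)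
    (hT : T.PosSemidef) {c : ℝ} (hc0 : 0 ≤ c) (hc1 : c ≤ 1) :
    (c • cfc f S + (1 - c) • cfc f T - cfc f (c • S + (1 - c) • T)).PosSemidef := by
  let e := Fintype.equivFin n
  let φ := reindexAlgEquiv ℝ ℂ e
  have hφ {M : Matrix n n ℂ} (hM : M.IsHermitian) : (φ M).IsHermitian := hM.submatrix _
  have hφcfc {M : Matrix n n ℂ} (hM : M.IsHermitian) : cfc f (φ M) = φ (cfc f M) :=
    hM.cfc_map φ.toAlgHom (hφ hM) f
  have hφpos {M : Matrix n n ℂ} (hM : M.PosSemidef) : (φ M).PosSemidef := hM.submatrix _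
  have hST : (c • S + (1 - c) • T).IsHermitian :=
    (hS.smul hc0).isHermitian.add (hT.smul (sub_nonneg.2 hc1)).isHermitian
  have h := hf _ (φ S) (φ T) (hφ hS.1) (hφ hT.1) (hφpos hS).spectrum_real_subset
    (hφpos hT).spectrum_real_subset c hc0 hc1
  rw [← map_smul, ← map_smul, ← map_add, hφcfc hS.1, hφcfc hT.1, hφcfc hST, ← map_smul,
    ← map_smul, ← map_add, ← map_sub] at h
  exact (posSemidef_submatrix_equiv e.symm).1 h

/-- The Hansen–Pedersen form of Jensen's operator inequality, with two terms. -/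
theorem jensen (hf : IsMatrixConvexOnIci f) {A B X Y : Matrix n n ℂ} (hA : IsUnit A)
    (hAB : Aᴴ * A + Bᴴ * B = 1) (hX : X.PosSemidef) (hY : Y.PosSemidef) :
    (Aᴴ * cfc f X * A + Bᴴ * cfc f Y * B - cfc f (Aᴴ * X * A + Bᴴ * Y * B)).PosSemidef := by
  obtain ⟨C, D, hU⟩ := exists_unitary_fromBlocks hA hAB
  set U := fromBlocks A C B D with hUdef
  let S : Matrix (n ⊕ n) (n ⊕ n) ℂ := fromBlocks 1 0 0 (-1)
  have hSH : Sᴴ = S := by simp [S, fromBlocks_conjTranspose]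
  have hS : Sᴴ * S = 1 := by simp [hSH, S, fromBlocks_multiply]
  have hW := hX.fromBlocks_diagonal hY
  have hZ := hW.conjTranspose_mul_mul_same U
  have hconj (P Q : Matrix n n ℂ) : Uᴴ * fromBlocks P 0 0 Q * U =
      fromBlocks (Aᴴ * P * A + Bᴴ * Q * B) (Aᴴ * P * C + Bᴴ * Q * D)
        (Cᴴ * P * A + Dᴴ * Q * B) (Cᴴ * P * C + Dᴴ * Q * D) := by
    simp [hUdef, fromBlocks_conjTranspose, fromBlocks_multiply]
  have hpinch (a b c d : Matrix n n ℂ) : (1 / 2 : ℝ) • fromBlocks a b c d +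
      (1 - 1 / 2 : ℝ) • (Sᴴ * fromBlocks a b c d * S) = fromBlocks a 0 0 d := by
    rw [hSH]
    have h2 (M : Matrix n n ℂ) : (1 / 2 : ℝ) • M + (1 - 1 / 2 : ℝ) • M = M := by
      rw [← add_smul]; norm_num
    have h0 (M : Matrix n n ℂ) : (1 / 2 : ℝ) • M + (1 - 1 / 2 : ℝ) • (-M) = 0 := by
      rw [smul_neg, ← sub_eq_add_neg, ← sub_smul]; norm_num
    simp only [S, fromBlocks_multiply, fromBlocks_smul, fromBlocks_add]
    simp only [one_mul, mul_one, zero_mul, mul_zero, add_zero, zero_add, neg_mul, mul_neg,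
      neg_neg, h2, h0]
  have h := hf.posSemidef hZ (hZ.conjTranspose_mul_mul_same S) (c := 1 / 2) (by norm_num)
    (by norm_num)
  have hblocks := hconj X Y ▸ hZ.isHermitian
  rw [isHermitian_fromBlocks_iff] at hblocks
  rw [cfc_unitary_conj hS hZ.isHermitian, cfc_unitary_conj hU hW.isHermitian,
    cfc_fromBlocks_diagonal hX.isHermitian hY.isHermitian, hconj, hconj, hpinch, hpinch,
    cfc_fromBlocks_diagonal hblocks.1 hblocks.2.2.2] at h
  exact h.submatrix Sum.inl

end IsMatrixConvexOnIci

/-- Perspectives expressed through a Hermitian square root `Q` of `R`. -/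
theorem exists_sqrt_conj_eq_matrixPerspective (f : ℝ → ℝ) {k : ℕ}
    {L R : Matrix (Fin k) (Fin k) ℂ} (hL : L.PosDef) (hR : R.PosDef) (hLR : Commute L R) :
    ∃ Q : Matrix (Fin k) (Fin k) ℂ, Qᴴ = Q ∧ IsUnit Q ∧ Q * Q = R ∧ (L * R⁻¹).PosSemidef ∧
      Q * (L * R⁻¹) * Q = L ∧ Q * cfc f (L * R⁻¹) * Q = matrixPerspective f L R := by
  obtain ⟨Q, hQ, hQu, hQQ, hcomm⟩ := hR.exists_isHermitian_mul_self_eq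
  have hR' := (isUnit_iff_isUnit_det _).1 hR.isUnit
  have hQ' := (isUnit_iff_isUnit_det _).1 hQu
  have hRX : Commute R (L * R⁻¹) := by
    rw [commute_iff_eq, ← mul_assoc, ← hLR.eq, mul_assoc, mul_assoc, mul_nonsing_inv _ hR',
      nonsing_inv_mul _ hR']
  have hQX := hcomm _ hRX
  have hconj : Q * (L * R⁻¹) * Q = L := by
    rw [hQX.eq, mul_assoc, hQQ, mul_assoc, nonsing_inv_mul _ hR', mul_one]
  refine ⟨Q, hQ, hQu, hQQ, ?_, hconj, ?_⟩
  · have h := hL.posSemidef.conjTranspose_mul_mul_same Q⁻¹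
    rwa [hQ.inv.eq, ← hconj, mul_assoc Q, nonsing_inv_mul_cancel_left _ _ hQ',
      mul_nonsing_inv_cancel_right _ _ hQ'] at h
  · rw [← (hQX.symm.cfc_real f).eq, mul_assoc, hQQ, matrixPerspective]

/-- The matrix perspective of a continuous matrix convex function `f : [0,∞) → ℝ` is jointly
convex on commuting pairs of positive definite matrices, in the Loewner order. -/
theorem matrixPerspective_jointly_convex (f : ℝ → ℝ)
    (hf : ContinuousOn f (Set.Ici 0)) (hconv : IsMatrixConvexOnIci f)
    {k : ℕ} (L₁ R₁ L₂ R₂ L R : Matrix (Fin k) (Fin k) ℂ)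
    (hL₁ : L₁.PosDef) (hR₁ : R₁.PosDef) (hL₂ : L₂.PosDef) (hR₂ : R₂.PosDef)
    (hc₁ : Commute L₁ R₁) (hc₂ : Commute L₂ R₂)
    (c : ℝ) (hc0 : 0 ≤ c) (hc1 : c ≤ 1)
    (hL : L = c • L₁ + (1 - c) • L₂) (hR : R = c • R₁ + (1 - c) • R₂)
    (hcLR : Commute L R) :
    (c • matrixPerspective f L₁ R₁ + (1 - c) • matrixPerspective f L₂ R₂
      - matrixPerspective f L R).PosSemidef := by
  rcases hc0.eq_or_lt with rfl | hcpos
  · simpa [hL, hR] using PosSemidef.zero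
  have hLpos : L.PosDef :=
    hL ▸ (hL₁.smul hcpos).add_posSemidef (hL₂.posSemidef.smul (sub_nonneg.2 hc1))
  have hRpos : R.PosDef :=
    hR ▸ (hR₁.smul hcpos).add_posSemidef (hR₂.posSemidef.smul (sub_nonneg.2 hc1))
  obtain ⟨Q₁, hQ₁, hQu₁, hQQ₁, hX₁, hXL₁, hg₁⟩ :=
    exists_sqrt_conj_eq_matrixPerspective f hL₁ hR₁ hc₁
  obtain ⟨Q₂, hQ₂, -, hQQ₂, hX₂, hXL₂, hg₂⟩ :=
    exists_sqrt_conj_eq_matrixPerspective f hL₂ hR₂ hc₂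
  obtain ⟨Q, hQ, hQu, hQQ, -, hXL, hg⟩ :=
    exists_sqrt_conj_eq_matrixPerspective f hLpos hRpos hcLR
  have hQ' := (isUnit_iff_isUnit_det _).1 hQu
  have hQinv : (Q⁻¹)ᴴ = Q⁻¹ := by rw [conjTranspose_nonsing_inv, hQ]
  let A := √c • (Q₁ * Q⁻¹)
  let B := √(1 - c) • (Q₂ * Q⁻¹)
  have hA (M : Matrix (Fin k) (Fin k) ℂ) : Aᴴ * M * A = Q⁻¹ * (c • (Q₁ * M * Q₁)) * Q⁻¹ := by
    simp [A, hQ₁, hQinv, smul_smul, mul_assoc, Real.mul_self_sqrt hc0]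
  have hB (M : Matrix (Fin k) (Fin k) ℂ) :
      Bᴴ * M * B = Q⁻¹ * ((1 - c) • (Q₂ * M * Q₂)) * Q⁻¹ := by
    simp [B, hQ₂, hQinv, smul_smul, mul_assoc, Real.mul_self_sqrt (sub_nonneg.2 hc1)]
  have hconj (M : Matrix (Fin k) (Fin k) ℂ) : Q⁻¹ * (Q * M * Q) * Q⁻¹ = M := by
    rw [mul_assoc Q, nonsing_inv_mul_cancel_left _ _ hQ', mul_nonsing_inv_cancel_right _ _ hQ']
  have hconj' (M : Matrix (Fin k) (Fin k) ℂ) : Q * (Q⁻¹ * M * Q⁻¹) * Q = M := by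
    rw [mul_assoc Q⁻¹, mul_nonsing_inv_cancel_left _ _ hQ', nonsing_inv_mul_cancel_right _ _ hQ']
  have hAu : IsUnit A :=
    ((hQu₁.mul (isUnit_nonsing_inv_iff.2 hQu)).smul (Units.mk0 √c (Real.sqrt_pos.2 hcpos).ne'))
  have hAB : Aᴴ * A + Bᴴ * B = 1 := by
    rw [← mul_one Aᴴ, ← mul_one Bᴴ, hA, hB, mul_one, mul_one, hQQ₁, hQQ₂, ← add_mul, ← mul_add,
      ← hR, ← hQQ]
    simpa using hconj 1
  have h := (hconv.jensen hAu hAB hX₁ hX₂).conjTranspose_mul_mul_same Q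
  rw [hA, hB, hA, hB, hXL₁, hXL₂, hg₁, hg₂, ← add_mul, ← mul_add, ← add_mul, ← mul_add, ← hL,
    hQ, mul_sub, sub_mul, hconj', ← hXL, hconj, hg] at h
  exact h
end
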